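/- (Signature counts chiral quadruples) For any configuration L of 5 pairwise skew lines in RP³, the absolute value of the signature of L equals twice the number of 4-element subsets S⊂L that form chiral configurations, i.e., |sgn(L)| = 2·#{S⊂L : |S|=4 and S is not deformation equivalent to any mirror image of S}. -/

import Mathlib

open Submodule

abbrev V4 : Type := Fin 4 → ℝ

abbrev PLine : Type := Submodule ℝ V4

def IsLine (P : PLine) : Prop := Module.finrank ℝ P = 2

def Skew (P Q : PLine) : Prop := IsLine P ∧ IsLine Q ∧ P ⊓ Q = ⊥

def PairwiseSkew {n : ℕ} (L : Fin n → PLine) : Prop :=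
  ∀ i j : Fin n, i ≠ j → Skew (L i) (L j)

noncomputable def det2 (a b c d : V4) : ℝ := Matrix.det (Matrix.of ![a, b, c, d])

open Classical in
noncomputable def lk (P Q R : PLine) : ℝ :=
  if h : ∃ v : Fin 6 → V4,
      P = span ℝ {v 0, v 1} ∧ Q = span ℝ {v 2, v 3} ∧ R = span ℝ {v 4, v 5} then
    Real.sign (det2 (h.choose 0) (h.choose 1) (h.choose 2) (h.choose 3) *
      det2 (h.choose 0) (h.choose 1) (h.choose 4) (h.choose 5) *
      det2 (h.choose 2) (h.choose 3) (h.choose 4) (h.choose 5))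
  else 0

noncomputable def sgnOf {n : ℕ} (L : Fin n → PLine) : ℝ :=
  ∑ i : Fin n, ∑ j : Fin n, ∑ k : Fin n,
    if i < j ∧ j < k then lk (L i) (L j) (L k) else 0

def ContinuousLineFamily (L : ℝ → PLine) : Prop :=
  ∃ v w : ℝ → V4, ContinuousOn v (Set.Icc 0 1) ∧ ContinuousOn w (Set.Icc 0 1) ∧
    ∀ t ∈ Set.Icc (0:ℝ) 1, L t = span ℝ {v t, w t}

def Deformation {n : ℕ} (L L' : Fin n → PLine) : Prop :=
  ∃ F : ℝ → Fin n → PLine,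
    (∀ i, ContinuousLineFamily (fun t => F t i)) ∧
    (∀ t ∈ Set.Icc (0:ℝ) 1, PairwiseSkew (F t)) ∧
    F 0 = L ∧ F 1 = L'

def DeformEquiv {n : ℕ} (L L' : Fin n → PLine) : Prop :=
  ∃ π π' : Equiv.Perm (Fin n), Deformation (L ∘ π) (L' ∘ π')

def IsMirror {n : ℕ} (L L' : Fin n → PLine) : Prop :=
  ∃ A : V4 →ₗ[ℝ] V4, LinearMap.det A < 0 ∧ ∀ i, L' i = (L i).map A

def CoarseDeformEquiv {n : ℕ} (L L' : Fin n → PLine) : Prop :=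
  DeformEquiv L L' ∨ ∃ M : Fin n → PLine, IsMirror L' M ∧ DeformEquiv L M

noncomputable def joinConfig {n : ℕ} (σ : Equiv.Perm (Fin n)) : Fin n → PLine :=
  fun i => span ℝ {![1, (i.val : ℝ) + 1, 0, 0], ![0, 0, ((σ i).val : ℝ) + 1, 1]}

def IsSchlafliSix (L : Fin 6 → PLine) : Prop :=
  PairwiseSkew L ∧
  ∃ F : MvPolynomial (Fin 4) ℝ,
    F ≠ 0 ∧ F.IsHomogeneous 3 ∧
    (∀ i : Fin 6, ∀ x ∈ L i, MvPolynomial.eval x F = 0) ∧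
    (∀ z : Fin 4 → ℂ, z ≠ 0 →
      MvPolynomial.eval z (MvPolynomial.map (algebraMap ℝ ℂ) F) = 0 →
      ∃ j : Fin 4, MvPolynomial.eval z (MvPolynomial.map (algebraMap ℝ ℂ) (MvPolynomial.pderiv j F)) ≠ 0)

def Reducible {n : ℕ} (L : Fin n → PLine) : Prop :=
  ∃ i j : Fin n, i ≠ j ∧ ∃ F : ℝ → Fin n → PLine,
    (∀ k, ContinuousLineFamily (fun t => F t k)) ∧
    F 0 = L ∧
    (∀ t ∈ Set.Ico (0:ℝ) 1, PairwiseSkew (F t)) ∧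
    F 1 i = F 1 j ∧
    (∀ k l : Fin n, k ≠ l → ¬(k = i ∧ l = j) → ¬(k = j ∧ l = i) → Skew (F 1 k) (F 1 l))


theorem real_sign_mul (x y : ℝ) : Real.sign (x * y) = Real.sign x * Real.sign y := by
  rcases lt_trichotomy x 0 with hx | rfl | hx <;> rcases lt_trichotomy y 0 with hy | rfl | hy <;>
    simp [Real.sign_of_neg, Real.sign_of_pos, mul_pos_of_neg_of_neg, mul_neg_of_neg_of_pos,
      mul_neg_of_pos_of_neg, *]

theorem det2_swap (a b c d : V4) : det2 a b c d = det2 c d a b := by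
  simp [det2, Matrix.det_succ_row_zero, Fin.sum_univ_succ, Fin.succAbove]
  ring

theorem det2_combination (a b c d : V4) (x y z w : ℝ) :
    det2 (x • a + y • b) (z • a + w • b) c d = (x * w - y * z) * det2 a b c d := by
  simp [det2, Matrix.det_succ_row_zero, Fin.sum_univ_succ, Fin.succAbove]
  ring

theorem det2_add_combination (a b c d : V4) (x y z w : ℝ) :
    det2 a b (a + (x • c + y • d)) (b + (z • c + w • d)) = (x * w - y * z) * det2 c d a b := by
  simp [det2, Matrix.det_succ_row_zero, Fin.sum_univ_succ, Fin.succAbove]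
  ring

theorem det2_add_right (a b c d : V4) : det2 a b (a + c) (b + d) = det2 a b c d := by
  simp [det2, Matrix.det_succ_row_zero, Fin.sum_univ_succ, Fin.succAbove]
  ring

theorem det2_map (A : V4 →ₗ[ℝ] V4) (a b c d : V4) :
    det2 (A a) (A b) (A c) (A d) = LinearMap.det A * det2 a b c d := by
  have h : Matrix.of ![A a, A b, A c, A d] =
      Matrix.of ![a, b, c, d] * (LinearMap.toMatrix' A).transpose := by
    have key (v : V4) (j : Fin 4) : A v j = ∑ k, v k * LinearMap.toMatrix' A j k := by
      conv_lhs => rw [← LinearMap.toMatrix'_mulVec A v]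
      simp only [Matrix.mulVec, dotProduct, mul_comm]
    ext i j
    rw [Matrix.mul_apply]
    simp only [Matrix.transpose_apply, Matrix.of_apply]
    fin_cases i <;> exact key _ j
  rw [det2, h, Matrix.det_mul, Matrix.det_transpose, LinearMap.det_toMatrix', mul_comm, det2]

theorem continuousOn_det2 {s : Set ℝ} {a b c d : ℝ → V4} (ha : ContinuousOn a s)
    (hb : ContinuousOn b s) (hc : ContinuousOn c s) (hd : ContinuousOn d s) :
    ContinuousOn (fun t => det2 (a t) (b t) (c t) (d t)) s := by
  rw [continuousOn_pi] at ha hb hc hd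
  simp only [det2, Matrix.det_succ_row_zero, Fin.sum_univ_succ]
  simp
  fun_prop

theorem IsLine.exists_span_pair {P : PLine} (h : IsLine P) : ∃ a b : V4, P = span ℝ {a, b} := by
  let e := Module.finBasisOfFinrankEq ℝ P h
  refine ⟨e 0, e 1, ?_⟩
  have := congrArg (Submodule.map P.subtype) e.span_eq
  rw [Submodule.map_span, Submodule.map_subtype_top, ← Set.range_comp] at this
  refine this.symm.trans (congrArg (span ℝ) ?_)
  ext x
  simp [Fin.exists_fin_two, eq_comm]

theorem IsLine.linearIndependent {a b : V4} (h : IsLine (span ℝ {a, b})) :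
    LinearIndependent ℝ ![a, b] := by
  rw [linearIndependent_iff_card_eq_finrank_span]
  have : Set.range ![a, b] = {a, b} := by simp [Set.pair_comm]
  rw [Set.finrank, this, h, Fintype.card_fin]

theorem Skew.det2_ne_zero {a b c d : V4} (h : Skew (span ℝ {a, b}) (span ℝ {c, d})) :
    det2 a b c d ≠ 0 := by
  intro h0
  obtain ⟨v, hv, hv0⟩ := Matrix.exists_vecMul_eq_zero_iff.2 h0
  have hsum : (v 0 • a + v 1 • b) + (v 2 • c + v 3 • d) = 0 := by
    ext j
    have := congrFun hv0 j
    simp [Matrix.vecMul, dotProduct, Fin.sum_univ_four] at this ⊢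
    linarith
  have hab : v 0 • a + v 1 • b ∈ span ℝ {a, b} := mem_span_pair.2 ⟨_, _, rfl⟩
  have hcd : v 2 • c + v 3 • d ∈ span ℝ {c, d} := mem_span_pair.2 ⟨_, _, rfl⟩
  have hz : v 0 • a + v 1 • b = 0 := by
    rw [← Submodule.mem_bot ℝ, ← h.2.2]
    refine ⟨hab, ?_⟩
    rw [eq_neg_of_add_eq_zero_left hsum]
    exact neg_mem hcd
  rw [hz, zero_add] at hsum
  obtain ⟨h0, h1⟩ := LinearIndependent.pair_iff.1 h.1.linearIndependent _ _ hz
  obtain ⟨h2, h3⟩ := LinearIndependent.pair_iff.1 h.2.1.linearIndependent _ _ hsum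
  apply hv
  ext i
  fin_cases i <;> assumption

theorem exists_det2_eq_mul {a b a' b' : V4} (h : span ℝ {a', b'} = span ℝ {a, b}) :
    ∃ k : ℝ, ∀ c d, det2 a' b' c d = k * det2 a b c d := by
  have ha : a' ∈ span ℝ {a, b} := h ▸ subset_span (by simp)
  have hb : b' ∈ span ℝ {a, b} := h ▸ subset_span (by simp)
  obtain ⟨x, y, rfl⟩ := mem_span_pair.1 ha
  obtain ⟨z, w, rfl⟩ := mem_span_pair.1 hb
  exact ⟨_, fun c d => det2_combination a b c d x y z w⟩

theorem lk_span {a b c d e f : V4} (hPQ : Skew (span ℝ {a, b}) (span ℝ {c, d}))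
    (hQR : Skew (span ℝ {c, d}) (span ℝ {e, f})) :
    lk (span ℝ {a, b}) (span ℝ {c, d}) (span ℝ {e, f}) =
      Real.sign (det2 a b c d * det2 a b e f * det2 c d e f) := by
  have h : ∃ v : Fin 6 → V4, span ℝ {a, b} = span ℝ {v 0, v 1} ∧
      span ℝ {c, d} = span ℝ {v 2, v 3} ∧ span ℝ {e, f} = span ℝ {v 4, v 5} :=
    ⟨![a, b, c, d, e, f], rfl, rfl, rfl⟩
  rw [lk, dif_pos h]
  obtain ⟨h1, h2, h3⟩ := h.choose_spec
  generalize h.choose = v at *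
  obtain ⟨k, hk⟩ := exists_det2_eq_mul h1
  obtain ⟨l, hl⟩ := exists_det2_eq_mul h2
  obtain ⟨m, hm⟩ := exists_det2_eq_mul h3
  have eq1 : det2 a b c d = k * l * det2 (v 0) (v 1) (v 2) (v 3) := by
    rw [hk, det2_swap, hl, det2_swap]; ring
  have eq2 : det2 a b e f = k * m * det2 (v 0) (v 1) (v 4) (v 5) := by
    rw [hk, det2_swap, hm, det2_swap]; ring
  have eq3 : det2 c d e f = l * m * det2 (v 2) (v 3) (v 4) (v 5) := by
    rw [hl, det2_swap, hm, det2_swap]; ring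
  have n1 := hPQ.det2_ne_zero
  have n3 := hQR.det2_ne_zero
  rw [eq1] at n1
  rw [eq3] at n3
  have hpos : 0 < (k * l * m) ^ 2 := by
    have hk0 : k ≠ 0 := by rintro rfl; simp at n1
    have hl0 : l ≠ 0 := by rintro rfl; simp at n1
    have hm0 : m ≠ 0 := by rintro rfl; simp at n3
    positivity
  rw [eq1, eq2, eq3]
  have : k * l * det2 (v 0) (v 1) (v 2) (v 3) * (k * m * det2 (v 0) (v 1) (v 4) (v 5)) *
      (l * m * det2 (v 2) (v 3) (v 4) (v 5)) = (k * l * m) ^ 2 *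
      (det2 (v 0) (v 1) (v 2) (v 3) * det2 (v 0) (v 1) (v 4) (v 5) *
        det2 (v 2) (v 3) (v 4) (v 5)) := by ring
  rw [this, real_sign_mul (_ ^ 2), Real.sign_of_pos hpos, one_mul]

theorem PairwiseSkew.isLine {n : ℕ} [Nontrivial (Fin n)] {L : Fin n → PLine}
    (hL : PairwiseSkew L) (i : Fin n) : IsLine (L i) :=
  have ⟨j, hj⟩ := exists_ne i
  (hL i j hj.symm).1

/-- A symmetric matrix of signs of determinants computes all triple linking indices. -/
theorem PairwiseSkew.exists_sign_matrix {n : ℕ} [Nontrivial (Fin n)] {L : Fin n → PLine}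
    (hL : PairwiseSkew L) :
    ∃ s : Fin n → Fin n → ℝ, (∀ i j, s i j = s j i) ∧
      (∀ i j, i ≠ j → s i j = 1 ∨ s i j = -1) ∧
      ∀ i j k, i ≠ j → i ≠ k → j ≠ k → lk (L i) (L j) (L k) = s i j * s i k * s j k := by
  choose v w hvw using fun i => (hL.isLine i).exists_span_pair
  refine ⟨fun i j => Real.sign (det2 (v i) (w i) (v j) (w j)), fun i j => ?_, fun i j hij => ?_,
    fun i j k hij hik hjk => ?_⟩
  · exact congrArg Real.sign (det2_swap _ _ _ _)
  · have h := hL i j hij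
    rw [hvw i, hvw j] at h
    exact (Real.sign_apply_eq_of_ne_zero _ h.det2_ne_zero).symm
  · have h1 := hL i j hij
    have h3 := hL j k hjk
    rw [hvw i, hvw j] at h1
    rw [hvw j, hvw k] at h3
    rw [hvw i, hvw j, hvw k, lk_span h1 h3]
    simp only [real_sign_mul]

theorem Deformation.lk_eq {n : ℕ} {L L' : Fin n → PLine} (h : Deformation L L') {i j k : Fin n}
    (hij : i ≠ j) (hik : i ≠ k) (hjk : j ≠ k) :
    lk (L i) (L j) (L k) = lk (L' i) (L' j) (L' k) := by
  obtain ⟨F, hF, hskew, rfl, rfl⟩ := h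
  choose v w hv hw hvw using hF
  beta_reduce at hvw
  let g : ℝ → ℝ := fun t => det2 (v i t) (w i t) (v j t) (w j t) *
    det2 (v i t) (w i t) (v k t) (w k t) * det2 (v j t) (w j t) (v k t) (w k t)
  have hg : ContinuousOn g (Set.Icc 0 1) :=
    ((continuousOn_det2 (hv i) (hw i) (hv j) (hw j)).mul
      (continuousOn_det2 (hv i) (hw i) (hv k) (hw k))).mul
      (continuousOn_det2 (hv j) (hw j) (hv k) (hw k))
  have sk (t : ℝ) (ht : t ∈ Set.Icc (0:ℝ) 1) (a b : Fin n) (hab : a ≠ b) :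
      Skew (span ℝ {v a t, w a t}) (span ℝ {v b t, w b t}) := by
    rw [← hvw a t ht, ← hvw b t ht]
    exact hskew t ht a b hab
  have hlk (t : ℝ) (ht : t ∈ Set.Icc (0:ℝ) 1) : lk (F t i) (F t j) (F t k) = Real.sign (g t) := by
    rw [hvw i t ht, hvw j t ht, hvw k t ht,
      lk_span (sk t ht i j hij) (sk t ht j k hjk)]
  have hne (t : ℝ) (ht : t ∈ Set.Icc (0:ℝ) 1) : g t ≠ 0 :=
    mul_ne_zero (mul_ne_zero (sk t ht i j hij).det2_ne_zero (sk t ht i k hik).det2_ne_zero)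
      (sk t ht j k hjk).det2_ne_zero
  have h0 : (0:ℝ) ∈ Set.Icc (0:ℝ) 1 := by simp
  have h1 : (1:ℝ) ∈ Set.Icc (0:ℝ) 1 := by simp
  rw [hlk 0 h0, hlk 1 h1]
  rcases lt_or_gt_of_ne (hne 0 h0) with ha | ha <;> rcases lt_or_gt_of_ne (hne 1 h1) with hb | hb
  · rw [Real.sign_of_neg ha, Real.sign_of_neg hb]
  · obtain ⟨t, ht, ht0⟩ := intermediate_value_Icc zero_le_one hg ⟨ha.le, hb.le⟩
    exact absurd ht0 (hne t ht)
  · obtain ⟨t, ht, ht0⟩ := intermediate_value_Icc' zero_le_one hg ⟨hb.le, ha.le⟩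
    exact absurd ht0 (hne t ht)
  · rw [Real.sign_of_pos ha, Real.sign_of_pos hb]

theorem IsLine.map {P : PLine} (hP : IsLine P) {A : V4 →ₗ[ℝ] V4} (hA : LinearMap.det A ≠ 0) :
    IsLine (P.map A) := by
  exact (LinearEquiv.finrank_map_eq (LinearMap.equivOfDetNeZero A hA) P).trans hP

theorem Skew.map {P Q : PLine} (h : Skew P Q) {A : V4 →ₗ[ℝ] V4} (hA : LinearMap.det A ≠ 0) :
    Skew (P.map A) (Q.map A) := by
  have hinj : Function.Injective A := (LinearMap.equivOfDetNeZero A hA).injective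
  exact ⟨h.1.map hA, h.2.1.map hA, by rw [← Submodule.map_inf A hinj, h.2.2, Submodule.map_bot]⟩

theorem lk_map {P Q R : PLine} (hPQ : Skew P Q) (hPR : Skew P R) (hQR : Skew Q R)
    {A : V4 →ₗ[ℝ] V4} (hA : LinearMap.det A < 0) :
    lk (P.map A) (Q.map A) (R.map A) = -lk P Q R := by
  obtain ⟨a, b, rfl⟩ := hPQ.1.exists_span_pair
  obtain ⟨c, d, rfl⟩ := hPQ.2.1.exists_span_pair
  obtain ⟨e, f, rfl⟩ := hPR.2.1.exists_span_pair
  have k1 := hPQ.map hA.ne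
  have k3 := hQR.map hA.ne
  simp only [Submodule.map_span, Set.image_pair] at k1 k3 ⊢
  rw [lk_span k1 k3, lk_span hPQ hQR]
  simp only [det2_map, real_sign_mul, Real.sign_of_neg hA]
  ring

theorem span_pair_eq_of_sub_mem {P Q : PLine} {a b c d : V4} (hab : LinearIndependent ℝ ![a, b])
    (hQ : span ℝ {a, b} ⊓ Q = ⊥) (hP : IsLine P) (hc : c ∈ P) (hd : d ∈ P)
    (hac : a - c ∈ Q) (hbd : b - d ∈ Q) :
    P = span ℝ {c, d} ∧ LinearIndependent ℝ ![c, d] := by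
  have hli : LinearIndependent ℝ ![c, d] := by
    rw [LinearIndependent.pair_iff] at hab ⊢
    intro x y hxy
    apply hab
    rw [← Submodule.mem_bot ℝ, ← hQ]
    refine ⟨mem_span_pair.2 ⟨_, _, rfl⟩, ?_⟩
    have : x • a + y • b = x • (a - c) + y • (b - d) + (x • c + y • d) := by module
    rw [this, hxy, add_zero]
    exact add_mem (Q.smul_mem _ hac) (Q.smul_mem _ hbd)
  refine ⟨?_, hli⟩
  symm
  apply Submodule.eq_of_le_of_finrank_eq
  · rw [span_le]
    rintro x (rfl | rfl) <;> assumption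
  · have := finrank_span_eq_card hli
    rw [Matrix.range_cons, Matrix.range_cons, Matrix.range_empty, Set.union_empty,
      Set.singleton_union, Fintype.card_fin] at this
    rw [this, hP]

theorem Skew.exists_add {P Q : PLine} (h : Skew P Q) (x : V4) :
    ∃ p ∈ P, ∃ q ∈ Q, x = p + q := by
  have htop : P ⊔ Q = ⊤ := by
    apply Submodule.eq_top_of_finrank_eq
    have := Submodule.finrank_sup_add_finrank_inf_eq P Q
    rw [h.2.2, finrank_bot, h.1, h.2.1] at this
    simp at this ⊢
    omega
  obtain ⟨p, hp, q, hq, hx⟩ := Submodule.mem_sup.1 (htop ▸ Submodule.mem_top : x ∈ P ⊔ Q)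
  exact ⟨p, hp, q, hq, hx.symm⟩

theorem IsLine.map_eq {P Q : PLine} (hP : IsLine P) (hQ : IsLine Q) {A : V4 →ₗ[ℝ] V4}
    (hA : LinearMap.det A ≠ 0) (h : P.map A ≤ Q) : P.map A = Q :=
  Submodule.eq_of_le_of_finrank_eq h ((hP.map hA).trans hQ.symm)

/-- Four pairwise skew lines two of whose triples have opposite linking indices have an
orientation-reversing automorphism that exchanges the lines in pairs. -/
theorem exists_map_swap {P Q R S : PLine} (hPQ : Skew P Q) (hPR : Skew P R) (hPS : Skew P S)
    (hQR : Skew Q R) (hQS : Skew Q S) (hRS : Skew R S) (hlk : lk P Q R ≠ lk Q R S) :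
    ∃ A : V4 →ₗ[ℝ] V4, LinearMap.det A < 0 ∧
      P.map A = S ∧ S.map A = P ∧ Q.map A = R ∧ R.map A = Q := by
  obtain ⟨r₁, r₂, hR⟩ := hPR.2.1.exists_span_pair
  have hr : LinearIndependent ℝ ![r₁, r₂] := by
    have := hPR.2.1
    rw [hR] at this
    exact this.linearIndependent
  obtain ⟨p₁, hp₁, q₁, hq₁, rfl⟩ := hPQ.exists_add r₁
  obtain ⟨p₂, hp₂, q₂, hq₂, rfl⟩ := hPQ.exists_add r₂
  obtain ⟨hP, hp⟩ := span_pair_eq_of_sub_mem hr (by rw [← hR, inf_comm]; exact hQR.2.2) hPQ.1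
    hp₁ hp₂ (by simpa using hq₁) (by simpa using hq₂)
  obtain ⟨hQ, hq⟩ := span_pair_eq_of_sub_mem hr (by rw [← hR, inf_comm]; exact hPR.2.2) hPQ.2.1
    hq₁ hq₂ (by simpa using hp₁) (by simpa using hp₂)
  obtain ⟨t₁, ht₁, s₁, hs₁, hts₁⟩ := hPS.exists_add q₁
  obtain ⟨t₂, ht₂, s₂, hs₂, hts₂⟩ := hPS.exists_add q₂
  obtain ⟨hS, -⟩ := span_pair_eq_of_sub_mem hq (by rw [← hQ, inf_comm]; exact hPQ.2.2) hPS.2.1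
    hs₁ hs₂ (by simpa [hts₁] using ht₁) (by simpa [hts₂] using ht₂)
  rw [hP] at ht₁ ht₂
  obtain ⟨x, y, hxy⟩ := mem_span_pair.1 (neg_mem ht₁)
  obtain ⟨z, w, hzw⟩ := mem_span_pair.1 (neg_mem ht₂)
  obtain rfl : s₁ = q₁ + (x • p₁ + y • p₂) := by rw [hxy, hts₁]; abel
  obtain rfl : s₂ = q₂ + (z • p₁ + w • p₂) := by rw [hzw, hts₂]; abel
  clear hp₁ hp₂ hq₁ hq₂ ht₁ ht₂ hs₁ hs₂ hts₁ hts₂ hxy hzw hr hp hq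
  subst hP hQ hR hS
  have hD := hPQ.det2_ne_zero
  let e : Module.Basis (Fin 4) ℝ V4 :=
    basisOfLinearIndependentOfCardEqFinrank (b := ![p₁, p₂, q₁, q₂])
      (Matrix.linearIndependent_rows_of_det_ne_zero (A := Matrix.of ![p₁, p₂, q₁, q₂]) hD)
      (by simp)
  let A : V4 →ₗ[ℝ] V4 := e.constr ℝ ![q₁ + (x • p₁ + y • p₂), q₂ + (z • p₁ + w • p₂),
    (-x) • (p₁ + q₁) + (-y) • (p₂ + q₂), (-z) • (p₁ + q₁) + (-w) • (p₂ + q₂)]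
  have he (i : Fin 4) : e i = ![p₁, p₂, q₁, q₂] i :=
    congrFun (coe_basisOfLinearIndependentOfCardEqFinrank _ _) i
  have hA (i : Fin 4) := (congrArg A (he i).symm).trans (e.constr_basis ℝ _ i)
  have A1 : A p₁ = q₁ + (x • p₁ + y • p₂) := hA 0
  have A2 : A p₂ = q₂ + (z • p₁ + w • p₂) := hA 1
  have A3 : A q₁ = (-x) • (p₁ + q₁) + (-y) • (p₂ + q₂) := hA 2
  have A4 : A q₂ = (-z) • (p₁ + q₁) + (-w) • (p₂ + q₂) := hA 3
  clear hA he
  clear_value A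
  clear e
  have hdet := det2_map A p₁ p₂ q₁ q₂
  rw [A1, A2, A3, A4, det2_swap, det2_combination] at hdet
  have n1 := hQR.det2_ne_zero
  have n2 := hRS.det2_ne_zero
  have n3 := hQS.det2_ne_zero
  rw [lk_span hPQ hQR, lk_span hQR hRS] at hlk
  rw [det2_add_combination] at hlk n3
  rw [det2_add_right] at hlk
  have hneg : LinearMap.det A < 0 := by
    by_contra! h
    generalize det2 p₁ p₂ q₁ q₂ = D at *
    generalize det2 q₁ q₂ (p₁ + q₁) (p₂ + q₂) = E at *
    generalize det2 (p₁ + q₁) (p₂ + q₂) (q₁ + (x • p₁ + y • p₂)) (q₂ + (z • p₁ + w • p₂)) = F at *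
    have hk : x * w - y * z ≠ 0 := left_ne_zero_of_mul n3
    have hpos : 0 < LinearMap.det A := by
      refine h.lt_of_ne fun h0 => mul_ne_zero hk n2 ?_
      rw [← h0] at hdet
      linarith
    apply hlk
    have hY : E * ((x * w - y * z) * D) * F = E * (LinearMap.det A * D ^ 2) := by
      linear_combination E * D * hdet
    rw [hY, mul_comm (D * D) E, real_sign_mul E, real_sign_mul E,
      Real.sign_of_pos (mul_self_pos.2 hD),
      Real.sign_of_pos (mul_pos hpos (by positivity))]
  refine ⟨A, hneg, hPS.1.map_eq hPS.2.1 hneg.ne ?_, hPS.2.1.map_eq hPS.1 hneg.ne ?_,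
    hQR.1.map_eq hQR.2.1 hneg.ne ?_, hQR.2.1.map_eq hQR.1 hneg.ne ?_⟩
  all_goals
    rw [Submodule.map_span, Set.image_pair, span_le]
    rintro u (rfl | rfl)
    all_goals
      simp only [map_add, map_smul, A1, A2, A3, A4, SetLike.mem_coe]
      rw [mem_span_pair]
  · exact ⟨1, 0, by module⟩
  · exact ⟨0, 1, by module⟩
  · exact ⟨x * (x - 1) + y * z, x * y + y * (w - 1), by module⟩
  · exact ⟨z * (x - 1) + w * z, z * y + w * (w - 1), by module⟩
  · exact ⟨-x, -y, by module⟩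
  · exact ⟨-z, -w, by module⟩
  · exact ⟨1 - x, -y, by module⟩
  · exact ⟨-z, 1 - w, by module⟩

theorem deformation_refl {n : ℕ} [Nontrivial (Fin n)] {L : Fin n → PLine}
    (hL : PairwiseSkew L) : Deformation L L := by
  refine ⟨fun _ => L, fun i => ?_, fun _ _ => hL, rfl, rfl⟩
  obtain ⟨a, b, h⟩ := (hL.isLine i).exists_span_pair
  exact ⟨fun _ => a, fun _ => b, continuousOn_const, continuousOn_const, fun _ _ => h⟩

theorem PairwiseSkew.comp {m n : ℕ} {L : Fin n → PLine} (hL : PairwiseSkew L) {f : Fin m → Fin n}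
    (hf : Function.Injective f) : PairwiseSkew (L ∘ f) :=
  fun i j hij => hL (f i) (f j) (hf.ne hij)

theorem achiral_of_lk_ne {K : Fin 4 → PLine} (hK : PairwiseSkew K) (p q r s : Fin 4)
    (hd : [p, q, r, s].Nodup) (hlk : lk (K p) (K q) (K r) ≠ lk (K q) (K r) (K s)) :
    ∃ M : Fin 4 → PLine, IsMirror K M ∧ DeformEquiv K M := by
  simp only [List.nodup_cons, List.mem_cons, List.not_mem_nil, or_false, not_or,
    List.nodup_nil, and_true, not_false_eq_true] at hd
  obtain ⟨⟨hpq, hpr, hps⟩, ⟨hqr, hqs⟩, hrs⟩ := hd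
  obtain ⟨A, hA, hP, hS, hQ, hR⟩ := exists_map_swap (hK p q hpq) (hK p r hpr) (hK p s hps)
    (hK q r hqr) (hK q s hqs) (hK r s hrs) hlk
  let π : Equiv.Perm (Fin 4) := Equiv.swap p s * Equiv.swap q r
  refine ⟨K ∘ π, ⟨A, hA, fun i => ?_⟩, π, 1, deformation_refl (hK.comp π.injective)⟩
  have hi : i = p ∨ i = q ∨ i = r ∨ i = s := by omega
  rcases hi with rfl | rfl | rfl | rfl
  · simp [π, Equiv.swap_apply_of_ne_of_ne hpq hpr, hP]
  · simp [π, Equiv.swap_apply_of_ne_of_ne (Ne.symm hpr) hrs, hQ]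
  · simp [π, Equiv.swap_apply_of_ne_of_ne (Ne.symm hpq) hqs, hR]
  · simp [π, Equiv.swap_apply_of_ne_of_ne (Ne.symm hqs) (Ne.symm hrs), hS]

theorem chiral_iff {K : Fin 4 → PLine} (hK : PairwiseSkew K) :
    (¬ ∃ M : Fin 4 → PLine, IsMirror K M ∧ DeformEquiv K M) ↔
      lk (K 0) (K 1) (K 2) = lk (K 0) (K 1) (K 3) ∧
      lk (K 0) (K 1) (K 2) = lk (K 0) (K 2) (K 3) ∧
      lk (K 0) (K 1) (K 2) = lk (K 1) (K 2) (K 3) := by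
  obtain ⟨s, hsymm, hs, hlk⟩ := hK.exists_sign_matrix
  constructor
  · intro h
    refine ⟨?_, ?_, ?_⟩ <;> by_contra hne <;> apply h
    · refine achiral_of_lk_ne hK 2 0 1 3 (by decide) fun h' => hne ?_
      rw [← h', hlk _ _ _ (by decide) (by decide) (by decide),
        hlk _ _ _ (by decide) (by decide) (by decide), hsymm 2 0, hsymm 2 1]
      ring
    · refine achiral_of_lk_ne hK 1 0 2 3 (by decide) fun h' => hne ?_
      rw [← h', hlk _ _ _ (by decide) (by decide) (by decide),
        hlk _ _ _ (by decide) (by decide) (by decide), hsymm 1 0]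
      ring
    · exact achiral_of_lk_ne hK 0 1 2 3 (by decide) hne
  · rintro ⟨h1, h2, h3⟩ ⟨M, ⟨A, hA, hM⟩, π, π', hdef⟩
    have hall : ∀ i j k, i ≠ j → i ≠ k → j ≠ k →
        lk (K i) (K j) (K k) = lk (K 0) (K 1) (K 2) := by
      intro i j k hij hik hjk
      rw [hlk 0 1 2 (by decide) (by decide) (by decide)] at h1 h2 h3 ⊢
      rw [hlk _ _ _ (by decide) (by decide) (by decide)] at h1 h2 h3
      rw [hlk _ _ _ hij hik hjk]
      have c10 := hsymm 1 0
      have c20 := hsymm 2 0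
      have c30 := hsymm 3 0
      have c21 := hsymm 2 1
      have c31 := hsymm 3 1
      have c32 := hsymm 3 2
      fin_cases i <;> fin_cases j <;> first | exact absurd rfl hij | skip
      all_goals fin_cases k <;> first | exact absurd rfl hik | exact absurd rfl hjk | skip
      all_goals
        simp only [Fin.zero_eta, Fin.mk_one, Fin.reduceFinMk, c10, c20, c30, c21, c31, c32] <;>
          linarith
    have hinj := π.injective
    have hinj' := π'.injective
    have key := hdef.lk_eq (i := 0) (j := 1) (k := 2) (by decide) (by decide) (by decide)
    have n1 : π' 0 ≠ π' 1 := hinj'.ne (by decide)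
    have n2 : π' 0 ≠ π' 2 := hinj'.ne (by decide)
    have n3 : π' 1 ≠ π' 2 := hinj'.ne (by decide)
    simp only [Function.comp_apply, hM] at key
    rw [lk_map (hK _ _ n1) (hK _ _ n2) (hK _ _ n3) hA, hall _ _ _ n1 n2 n3,
      hall _ _ _ (hinj.ne (by decide)) (hinj.ne (by decide)) (hinj.ne (by decide)),
      hlk _ _ _ (by decide) (by decide) (by decide)] at key
    rcases hs 0 1 (by decide) with a | a <;> rcases hs 0 2 (by decide) with b | b <;>
      rcases hs 1 2 (by decide) with c | c <;> rw [a, b, c] at key <;> norm_num at key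

theorem sgn_counts_chiral_quadruples (L : Fin 5 → PLine) (hL : PairwiseSkew L) :
    |sgnOf L| = 2 * (({i : Fin 5 |
      ¬ ∃ M : Fin 4 → PLine, IsMirror (L ∘ i.succAbove) M ∧
        DeformEquiv (L ∘ i.succAbove) M}).ncard : ℝ) := by
  obtain ⟨s, -, hs, hlk⟩ := hL.exists_sign_matrix
  have hsq : ∀ i j, i ≠ j → s i j ^ 2 = 1 := fun i j hij => by
    rcases hs i j hij with h | h <;> rw [h] <;> norm_num
  have hpm : ∀ i j k, i ≠ j → i ≠ k → j ≠ k →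
      lk (L i) (L j) (L k) = 1 ∨ lk (L i) (L j) (L k) = -1 := fun i j k hij hik hjk => by
    rw [hlk i j k hij hik hjk]
    rcases hs i j hij with a | a <;> rcases hs i k hik with b | b <;>
      rcases hs j k hjk with c | c <;> rw [a, b, c] <;> norm_num
  have hcocycle : ∀ j k l, 0 ≠ j → 0 ≠ k → 0 ≠ l → j ≠ k → j ≠ l → k ≠ l →
      lk (L j) (L k) (L l) =
        lk (L 0) (L j) (L k) * lk (L 0) (L j) (L l) * lk (L 0) (L k) (L l) := by
    intro j k l hj hk hl hjk hjl hkl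
    rw [hlk j k l hjk hjl hkl, hlk 0 j k hj hk hjk, hlk 0 j l hj hl hjl, hlk 0 k l hk hl hkl]
    calc s j k * s j l * s k l
        = s 0 j ^ 2 * s 0 k ^ 2 * s 0 l ^ 2 * (s j k * s j l * s k l) := by
          rw [hsq 0 j hj, hsq 0 k hk, hsq 0 l hl]; ring
      _ = _ := by ring
  simp only [fun i : Fin 5 => chiral_iff (hL.comp (Fin.succAbove_right_injective (p := i)))]
  classical
  rw [Set.ncard_eq_toFinset_card', Set.toFinset_ofPred, Finset.card_filter]
  simp only [Fin.sum_univ_five, sgnOf, Function.comp_apply]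
  have e (i : Fin 5) (j : Fin 4) :
      i.succAbove j = if j.val < i.val then j.castSucc else j.succ := rfl
  simp [e]
  rw [hcocycle 1 2 3 (by decide) (by decide) (by decide) (by decide) (by decide) (by decide),
    hcocycle 1 2 4 (by decide) (by decide) (by decide) (by decide) (by decide) (by decide),
    hcocycle 1 3 4 (by decide) (by decide) (by decide) (by decide) (by decide) (by decide),
    hcocycle 2 3 4 (by decide) (by decide) (by decide) (by decide) (by decide) (by decide)]
  have h012 := hpm 0 1 2 (by decide) (by decide) (by decide)
  have h013 := hpm 0 1 3 (by decide) (by decide) (by decide)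
  have h014 := hpm 0 1 4 (by decide) (by decide) (by decide)
  have h023 := hpm 0 2 3 (by decide) (by decide) (by decide)
  have h024 := hpm 0 2 4 (by decide) (by decide) (by decide)
  have h034 := hpm 0 3 4 (by decide) (by decide) (by decide)
  generalize lk (L 0) (L 1) (L 2) = a at *
  generalize lk (L 0) (L 1) (L 3) = b at *
  generalize lk (L 0) (L 1) (L 4) = c at *
  generalize lk (L 0) (L 2) (L 3) = d at *
  generalize lk (L 0) (L 2) (L 4) = f at *
  generalize lk (L 0) (L 3) (L 4) = g at *
  clear hcocycle hpm hlk
  rcases h012 with rfl | rfl <;> rcases h013 with rfl | rfl <;> rcases h014 with rfl | rfl <;>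
    rcases h023 with rfl | rfl <;> rcases h024 with rfl | rfl <;> rcases h034 with rfl | rfl <;>
    norm_num
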